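/- Tree-grafting bijection with multiplicativity of the density: Fix q≥2, a colour π∈{τ}∪{σ_j : j∈{1,…,m}}, and consider tuples (u,t_1,…,t_{m(u)}) where u∈SLTS_q has its root coloured π and branch sizes δ_1,…,δ_{m(u)} (δ_1+…+δ_{m(u)}=q−1), and t_i∈LTS with l(t_i)=δ_i for each i. The operation of replacing, for each i, the i-th branch of u by the tree t_i and carrying the labels over in the same order (i.e. relabelling the nodes of t_i by the labels that u assigns to the nodes of its i-th branch, in increasing order) is a bijection from the set of all such tuples onto the set of all monotonically labelled S-trees t∈LTS with l(t)=q whose root has colour π, and under this bijection γ(t) = q·γ(t_1)⋯γ(t_{m(u)}). -/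

import Mathlib

open scoped BigOperators
open Finset MeasureTheory ProbabilityTheory

noncomputable section

namespace SRKPaper

/-- `ℝ^d` with the Euclidean norm. -/
abbrev Evec (d : ℕ) : Type := EuclideanSpace ℝ (Fin d)

/-- The index pairs `(k,ν)` of the SRK method: `det` is `(0,0)`,
`sto k ν` is `(k,ν)` with `k ∈ {1,…,m}`, `ν ∈ M`. -/
inductive SIdx (m : ℕ) (M : Type) : Type where
  | det : SIdx m M
  | sto : Fin m → M → SIdx m M

/-- `M̄ = M ∪ {0}`, with `none` playing the role of the index `0`. -/
abbrev Mbar (M : Type) : Type := Option M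

/-- The real coefficients of an autonomous `s`-stage stochastic Runge–Kutta method. -/
structure SRK (m s : ℕ) (M : Type) : Type where
  α : Fin s → ℝ
  γc : M → SIdx m M → Fin s → ℝ
  A : SIdx m M → Fin s → Fin s → ℝ
  B : M → SIdx m M → Fin m → M → Fin s → Fin s → ℝ

variable {d m s : ℕ} {M : Type}

section SRKdefs
variable [Fintype M]

/-- θ-dependent weights `z^{(k,ν)}`. -/
def SRK.z (c : SRK m s M) (θ : Mbar M → ℝ) : SIdx m M → Fin s → ℝ
  | .det => fun i => c.α i * θ none
  | .sto k ν => fun i => ∑ ι : M, c.γc ι (.sto k ν) i * θ (some ι)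

/-- θ-dependent stage coefficients `Z^{(k,ν),(r,μ)}`; the first index is the
father pair `p = (k,ν)`, the second the son pair. -/
def SRK.Z (c : SRK m s M) (θ : Mbar M → ℝ) (p : SIdx m M) : SIdx m M → Fin s → Fin s → ℝ
  | .det => fun i j => c.A p i j * θ none
  | .sto r μ => fun i j => ∑ ι : M, c.B ι p r μ i j * θ (some ι)

/-- The stage equations of the autonomous SRK method with starting value `y0`. -/
def StageEq (c : SRK m s M) (a : Evec d → Evec d) (b : Fin m → Evec d → Evec d)
    (y0 : Evec d) (θ : Mbar M → ℝ) (H : SIdx m M → Fin s → Evec d) : Prop :=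
  ∀ (p : SIdx m M) (i : Fin s),
    H p i = y0 + (∑ j, c.Z θ p .det i j • a (H .det j))
      + ∑ j, ∑ r, ∑ μ, c.Z θ p (.sto r μ) i j • b r (H (.sto r μ) j)

/-- The one-step value `Y(t)` of the SRK method. -/
def oneStep (c : SRK m s M) (a : Evec d → Evec d) (b : Fin m → Evec d → Evec d)
    (y0 : Evec d) (θ : Mbar M → ℝ) (H : SIdx m M → Fin s → Evec d) : Evec d :=
  y0 + (∑ i, c.z θ .det i • a (H .det i))
    + ∑ i, ∑ k, ∑ ν, c.z θ (.sto k ν) i • b k (H (.sto k ν) i)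

end SRKdefs

/-- A monotonically labelled S-tree with `l+1` nodes: node `0` is the root, the
nonroot nodes are labelled `1,…,l` and are represented by `Fin l` (node `i : Fin l`
has true label `i+1`).  `father i` is the father of node `i+1` (a node label in
`Fin (l+1)`), and `color i` is the colour of node `i+1`: `none` is a deterministic
node `τ`, `some j` a stochastic node `σ_j` with (concrete) variable index `j`. -/
structure STree (l m : ℕ) : Type where
  father : Fin l → Fin (l + 1)
  color : Fin l → Option (Fin m)
  mono : ∀ i : Fin l, (father i).val ≤ i.val

def STree.equivSubtype (l m : ℕ) :
    STree l m ≃ {p : (Fin l → Fin (l+1)) × (Fin l → Option (Fin m)) //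
      ∀ i : Fin l, (p.1 i).val ≤ i.val} where
  toFun t := ⟨(t.father, t.color), t.mono⟩
  invFun p := ⟨p.1.1, p.1.2, p.2⟩
  left_inv t := rfl
  right_inv p := rfl

instance (l m : ℕ) : Fintype (STree l m) := Fintype.ofEquiv _ (STree.equivSubtype l m).symm

/-- The set of sons of the node with label `v`. -/
def STree.child {l m : ℕ} (t : STree l m) (v : Fin (l+1)) : Finset (Fin l) :=
  Finset.univ.filter fun i => t.father i = v

/-- interpretation of a colour by the corresponding coefficient function (`b^0 = a`). -/
def nodeFun (a : Evec d → Evec d) (b : Fin m → Evec d → Evec d) :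
    Option (Fin m) → Evec d → Evec d
  | none => a
  | some j => b j

/-- The elementary differential attached to the subtree rooted at the nonroot node `i`
(fuel-based recursion; the fuel `l` always suffices). -/
def elemFAux (a : Evec d → Evec d) (b : Fin m → Evec d → Evec d) {l : ℕ} (t : STree l m) :
    ℕ → Fin l → Evec d → Evec d
  | 0, _, _ => 0
  | fuel + 1, i, x =>
      iteratedFDeriv ℝ (t.child i.succ).card (nodeFun a b (t.color i)) x
        fun p => elemFAux a b t fuel ((t.child i.succ).orderIsoOfFin rfl p).1 x

def elemF (a : Evec d → Evec d) (b : Fin m → Evec d → Evec d) {l : ℕ} (t : STree l m)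
    (i : Fin l) : Evec d → Evec d := elemFAux a b t l i

/-- The elementary differential `F(t)(x)` of a tree whose root has colour `γ`
(representing the functional `f`). -/
def elemFRoot (f : Evec d → ℝ) (a : Evec d → Evec d) (b : Fin m → Evec d → Evec d)
    {l : ℕ} (t : STree l m) (x : Evec d) : ℝ :=
  iteratedFDeriv ℝ (t.child 0).card f x
    fun p => elemF a b t ((t.child 0).orderIsoOfFin rfl p).1 x

/-- The elementary differential `F(t)(x)` of a tree whose root has colour `rc`
(`none = τ`, `some j = σ_j`). -/
def elemFRootV (a : Evec d → Evec d) (b : Fin m → Evec d → Evec d) (rc : Option (Fin m))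
    {l : ℕ} (t : STree l m) (x : Evec d) : Evec d :=
  iteratedFDeriv ℝ (t.child 0).card (nodeFun a b rc) x
    fun p => elemF a b t ((t.child 0).orderIsoOfFin rfl p).1 x

/-- number of nodes of the subtree rooted at the nonroot node `i` (fuel-based). -/
def sizeAux {l m : ℕ} (t : STree l m) : ℕ → Fin l → ℕ
  | 0, _ => 0
  | fuel + 1, i => 1 + ∑ c ∈ t.child i.succ, sizeAux t fuel c

def STree.size {l m : ℕ} (t : STree l m) (i : Fin l) : ℕ := sizeAux t l i

/-- density of the subtree rooted at the nonroot node `i`. -/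
def densAux {l m : ℕ} (t : STree l m) : ℕ → Fin l → ℕ
  | 0, _ => 1
  | fuel + 1, i => t.size i * ∏ c ∈ t.child i.succ, densAux t fuel c

def STree.densNode {l m : ℕ} (t : STree l m) (i : Fin l) : ℕ := densAux t l i

/-- density `γ(t)` of a tree whose root has colour `γ`. -/
def STree.densDelta {l m : ℕ} (t : STree l m) : ℕ := ∏ c ∈ t.child 0, t.densNode c

/-- density `γ(t)` of a tree (with `l+1` nodes) whose root has colour `τ` or `σ_j`. -/
def STree.densR {l m : ℕ} (t : STree l m) : ℕ := (l+1) * ∏ c ∈ t.child 0, t.densNode c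

/-- number `s(t)` of stochastic nonroot nodes. -/
def STree.scount {l m : ℕ} (t : STree l m) : ℕ :=
  (Finset.univ.filter fun i : Fin l => (t.color i).isSome = true).card

/-- number `d(t)` of deterministic nonroot nodes. -/
def STree.dcount {l m : ℕ} (t : STree l m) : ℕ :=
  (Finset.univ.filter fun i : Fin l => t.color i = none).card

section PhiDefs
variable [Fintype M]

/-- The vector `Ψ^{(p)}` of the subtree rooted at the nonroot node `i`, where `p` is
the index pair of the father of `i` (fuel-based recursion). -/
def PsiAux (c : SRK m s M) (θ : Mbar M → ℝ) {l : ℕ} (t : STree l m) :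
    ℕ → Fin l → SIdx m M → Fin s → ℝ
  | 0, _, _, _ => 1
  | fuel + 1, i, p, q =>
    match t.color i with
    | none => ∑ j, c.Z θ p .det q j * ∏ cc ∈ t.child i.succ, PsiAux c θ t fuel cc .det j
    | some jj => ∑ μ : M, ∑ j, c.Z θ p (.sto jj μ) q j *
        ∏ cc ∈ t.child i.succ, PsiAux c θ t fuel cc (.sto jj μ) j

def PsiN (c : SRK m s M) (θ : Mbar M → ℝ) {l : ℕ} (t : STree l m)
    (i : Fin l) (p : SIdx m M) (q : Fin s) : ℝ := PsiAux c θ t l i p q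

/-- the elementary-weight factor contributed by the subtree rooted at a son of the root. -/
def phiFactor (c : SRK m s M) (θ : Mbar M → ℝ) {l : ℕ} (t : STree l m) (i : Fin l) : ℝ :=
  match t.color i with
  | none => ∑ j, c.z θ .det j * ∏ cc ∈ t.child i.succ, PsiN c θ t cc .det j
  | some jj => ∑ μ : M, ∑ j, c.z θ (.sto jj μ) j *
      ∏ cc ∈ t.child i.succ, PsiN c θ t cc (.sto jj μ) j

/-- The elementary weight `Φ_S(t)` of a `γ`-rooted tree. -/
def PhiS (c : SRK m s M) (θ : Mbar M → ℝ) {l : ℕ} (t : STree l m) : ℝ :=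
  ∏ i ∈ t.child 0, phiFactor c θ t i

/-- `∑_{i₁} Z^{(k,ν)}_{i,i₁} Φ_{i₁}(t)` for a tree with root colour `rc`, the sum over
the pair `(j_r,ν_r)` of the root being shared between the `Z`-factor and `Φ`. -/
def ZPhi (c : SRK m s M) (θ : Mbar M → ℝ) (p : SIdx m M) (i : Fin s)
    (rc : Option (Fin m)) {l : ℕ} (t : STree l m) : ℝ :=
  match rc with
  | none => ∑ i1, c.Z θ p .det i i1 * ∏ cc ∈ t.child 0, PsiN c θ t cc .det i1
  | some jr => ∑ ν : M, ∑ i1, c.Z θ p (.sto jr ν) i i1 *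
      ∏ cc ∈ t.child 0, PsiN c θ t cc (.sto jr ν) i1

/-- `∑_{i₁} z_{i₁} Φ_{i₁}(t)` for a tree with root colour `rc`. -/
def zPhi (c : SRK m s M) (θ : Mbar M → ℝ)
    (rc : Option (Fin m)) {l : ℕ} (t : STree l m) : ℝ :=
  match rc with
  | none => ∑ i1, c.z θ .det i1 * ∏ cc ∈ t.child 0, PsiN c θ t cc .det i1
  | some jr => ∑ ν : M, ∑ i1, c.z θ (.sto jr ν) i1 *
      ∏ cc ∈ t.child 0, PsiN c θ t cc (.sto jr ν) i1

end PhiDefs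

/-- `D^q` with increments `Δ` applied to `g` at the point `θ0`:
`∑_{ν₁,…,ν_q ∈ M̄} Δθ_{ν₁}⋯Δθ_{ν_q} ∂^q g/(∂θ_{ν₁}⋯∂θ_{ν_q})(θ0)`. -/
def Dq {ι : Type} [Fintype ι] [DecidableEq ι] {F : Type}
    [NormedAddCommGroup F] [NormedSpace ℝ F]
    (q : ℕ) (Δ : ι → ℝ) (g : (ι → ℝ) → F) (θ0 : ι → ℝ) : F :=
  ∑ νs : Fin q → ι, (∏ r, Δ (νs r)) •
    iteratedFDeriv ℝ q g θ0 fun r => Pi.single (νs r) 1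

/-- `∑_{ν₁,…,ν_q ∈ M̄} ∂^q g/(∂θ_{ν₁}⋯∂θ_{ν_q})(θ0)`. -/
def DerSum {ι : Type} [Fintype ι] [DecidableEq ι] {F : Type}
    [NormedAddCommGroup F] [NormedSpace ℝ F]
    (q : ℕ) (g : (ι → ℝ) → F) (θ0 : ι → ℝ) : F :=
  ∑ νs : Fin q → ι, iteratedFDeriv ℝ q g θ0 fun r => Pi.single (νs r) 1

/-- the space `C_P^l`: `l` times continuously differentiable with all derivatives up
to order `l` of polynomial growth. -/
def IsCP {d : ℕ} {F : Type} [NormedAddCommGroup F] [NormedSpace ℝ F]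
    (l : ℕ) (g : Evec d → F) : Prop :=
  ContDiff ℝ l g ∧ ∀ i : ℕ, i ≤ l → ∃ K > (0:ℝ), ∃ r : ℕ,
    ∀ x, ‖iteratedFDeriv ℝ i g x‖ ≤ K * (1 + ‖x‖ ^ (2*r))

/-- A labelled tree is special if no node except possibly the root has more than one son. -/
def IsSpecial {q : ℕ} (t : STree q 0) : Prop :=
  ∀ i : Fin q, (t.child i.succ).card ≤ 1

instance {q : ℕ} : DecidablePred (IsSpecial (q := q)) := fun t => by
  unfold IsSpecial; infer_instance

end SRKPaper

namespace SRKPaper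

/-- the root-child ancestor of a nonroot node (fuel-based recursion). -/
def branchRootAux {q m : ℕ} (t : STree q m) : ℕ → Fin q → Fin q
  | 0, j => j
  | fuel + 1, j =>
    if h : t.father j = 0 then j
    else branchRootAux t fuel ((t.father j).pred h)

/-- the son of the root to whose branch the nonroot node `j` belongs. -/
def STree.branchRoot {q m : ℕ} (t : STree q m) (j : Fin q) : Fin q := branchRootAux t q j

/-- the set of nonroot nodes belonging to the branch rooted at the root child `cval`. -/
def STree.branchSet {q m : ℕ} (t : STree q m) (cval : Fin q) : Finset (Fin q) :=
  Finset.univ.filter fun j => t.branchRoot j = cval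

/-- A tuple `(t_1, …, t_{m(u)})` of coloured labelled trees (each given by a root
colour and an `STree`), the `i`-th tree having `δ_i` nodes, where `δ_i` is the number
of nodes of the `i`-th branch of the special tree `u`. -/
def GraftTup (m : ℕ) {q : ℕ} (u : STree q 0) : Type :=
  (i : Fin (u.child 0).card) →
    Option (Fin m) × STree ((u.branchSet ((u.child 0).orderIsoOfFin rfl i).1).card - 1) m

/-- father map of the tree obtained by replacing the branches of `u` by the trees of
the tuple, the labels being carried over in increasing order. -/
def graftFather (m : ℕ) {q : ℕ} (u : STree q 0) (tup : GraftTup m u) (j : Fin q) :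
    Fin (q+1) :=
  if hR : u.branchRoot j ∈ u.child 0 then
    let i : Fin (u.child 0).card := ((u.child 0).orderIsoOfFin rfl).symm ⟨u.branchRoot j, hR⟩
    let S : Finset (Fin q) := u.branchSet (((u.child 0).orderIsoOfFin rfl) i).1
    if hj : j ∈ S then
      let k : Fin S.card := (S.orderIsoOfFin rfl).symm ⟨j, hj⟩
      if hk : k.val = 0 then 0
      else
        let k0 : Fin (S.card - 1) := ⟨k.val - 1, by have hkl := k.isLt; omega⟩
        let fpos : ℕ := (((tup i).2).father k0).val
        if hf : fpos < S.card then ((S.orderIsoOfFin rfl) ⟨fpos, hf⟩).1.succ else 0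
    else 0
  else 0

/-- colour map of the grafted tree. -/
def graftColor (m : ℕ) {q : ℕ} (u : STree q 0) (tup : GraftTup m u) (j : Fin q) :
    Option (Fin m) :=
  if hR : u.branchRoot j ∈ u.child 0 then
    let i : Fin (u.child 0).card := ((u.child 0).orderIsoOfFin rfl).symm ⟨u.branchRoot j, hR⟩
    let S : Finset (Fin q) := u.branchSet (((u.child 0).orderIsoOfFin rfl) i).1
    if hj : j ∈ S then
      let k : Fin S.card := (S.orderIsoOfFin rfl).symm ⟨j, hj⟩
      if k.val = 0 then (tup i).1
      else if h2 : k.val - 1 < S.card - 1 then ((tup i).2).color ⟨k.val - 1, h2⟩ else none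
    else none
  else none

/-- The tree obtained by replacing, for each `i`, the `i`-th branch of `u` by the
`i`-th tree of the tuple, carrying the labels over in the same (increasing) order. -/
def graft (m : ℕ) {q : ℕ} (u : STree q 0) (tup : GraftTup m u) : STree q m :=
  if hm : ∀ j : Fin q, (graftFather m u tup j).val ≤ j.val then
    ⟨graftFather m u tup, graftColor m u tup, hm⟩
  else ⟨fun _ => 0, fun _ => none, fun _ => by simp⟩

section Branches

variable {q m : ℕ}

theorem STree.father_eq_zero_or (t : STree q m) (j : Fin q) :
    t.father j = 0 ∨ ∃ p : Fin q, p < j ∧ t.father j = p.succ := by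
  by_cases h : t.father j = 0
  · exact Or.inl h
  · refine Or.inr ⟨(t.father j).pred h, ?_, by simp⟩
    have h1 := t.mono j
    have h2 : (t.father j).val ≠ 0 := fun h' => h (Fin.ext h')
    rw [Fin.lt_def, Fin.val_pred]
    omega

theorem branchRootAux_eq (t : STree q m) (f f' : ℕ) (j : Fin q) (hf : j.val ≤ f)
    (hf' : j.val ≤ f') : branchRootAux t f j = branchRootAux t f' j := by
  induction f generalizing f' j with
  | zero =>
    have hj : j.val = 0 := by omega
    have h0 : t.father j = 0 := Fin.ext (by simpa [hj] using t.mono j)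
    cases f' <;> simp [branchRootAux, h0]
  | succ f ih =>
    rcases t.father_eq_zero_or j with h0 | ⟨p, hp, h⟩
    · cases f' <;> simp [branchRootAux, h0]
    · rw [Fin.lt_def] at hp
      obtain ⟨g, rfl⟩ : ∃ g, f' = g + 1 := ⟨f' - 1, by omega⟩
      simp only [branchRootAux, h, Fin.succ_ne_zero, dite_false, Fin.pred_succ]
      exact ih g p (by omega) (by omega)

theorem STree.branchRoot_of_father_eq_zero (t : STree q m) {j : Fin q} (h : t.father j = 0) :
    t.branchRoot j = j := by
  unfold STree.branchRoot
  cases q <;> simp [branchRootAux, h]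

theorem STree.branchRoot_of_father_eq_succ (t : STree q m) {j p : Fin q}
    (h : t.father j = p.succ) : t.branchRoot j = t.branchRoot p := by
  have h1 : p.val + 1 ≤ j.val := by simpa [h] using t.mono j
  have h2 := j.isLt
  unfold STree.branchRoot
  rw [branchRootAux_eq t q (q + 1) j (by omega) (by omega)]
  simp [branchRootAux, h]

theorem STree.father_branchRoot (t : STree q m) (j : Fin q) :
    t.father (t.branchRoot j) = 0 ∧ t.branchRoot j ≤ j := by
  induction j using WellFoundedLT.induction with
  | _ j ih =>
    rcases t.father_eq_zero_or j with h | ⟨p, hp, h⟩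
    · rw [t.branchRoot_of_father_eq_zero h]
      exact ⟨h, le_rfl⟩
    · rw [t.branchRoot_of_father_eq_succ h]
      exact ⟨(ih p hp).1, (ih p hp).2.trans hp.le⟩

theorem STree.branchRoot_le (t : STree q m) (j : Fin q) : t.branchRoot j ≤ j :=
  (t.father_branchRoot j).2

theorem STree.branchRoot_eq_self_iff (t : STree q m) (j : Fin q) :
    t.branchRoot j = j ↔ t.father j = 0 :=
  ⟨fun h => h ▸ (t.father_branchRoot j).1, t.branchRoot_of_father_eq_zero⟩

theorem STree.branchRoot_unique (t : STree q m) (f : Fin q → Fin q)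
    (h0 : ∀ j, t.father j = 0 → f j = j)
    (h1 : ∀ j p, t.father j = p.succ → f j = f p) (j : Fin q) : t.branchRoot j = f j := by
  induction j using WellFoundedLT.induction with
  | _ j ih =>
    rcases t.father_eq_zero_or j with h | ⟨p, hp, h⟩
    · rw [t.branchRoot_of_father_eq_zero h, h0 j h]
    · rw [t.branchRoot_of_father_eq_succ h, h1 j p h, ih p hp]

theorem STree.mem_child (t : STree q m) (v : Fin (q + 1)) (j : Fin q) :
    j ∈ t.child v ↔ t.father j = v := by
  simp [STree.child]

theorem STree.mem_branchSet (t : STree q m) (c j : Fin q) :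
    j ∈ t.branchSet c ↔ t.branchRoot j = c := by
  simp [STree.branchSet]

theorem STree.branchRoot_mem_child (t : STree q m) (j : Fin q) :
    t.branchRoot j ∈ t.child 0 :=
  (t.mem_child _ _).2 (t.father_branchRoot j).1

/-- In a special tree, no node of a branch lies strictly between a node and its father. -/
theorem IsSpecial.not_between {u : STree q 0} (hu : IsSpecial u) (y p x : Fin q)
    (hy : u.father y = p.succ) (hpx : p < x) (hxy : x < y)
    (hb : u.branchRoot x = u.branchRoot y) : False := by
  induction y using WellFoundedLT.induction generalizing p x with
  | _ y ihy =>
    induction x using WellFoundedLT.induction with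
    | _ x ihx =>
      rw [u.branchRoot_of_father_eq_succ hy] at hb
      rcases u.father_eq_zero_or x with h | ⟨z, hz, h⟩
      · rw [u.branchRoot_of_father_eq_zero h] at hb
        exact absurd (u.branchRoot_le p) (by rw [← hb]; exact not_le.2 hpx)
      · rcases lt_trichotomy z p with hzp | rfl | hzp
        · exact ihy x hxy z p h hzp hpx hb.symm
        · have := Finset.card_le_one.1 (hu z) x ((u.mem_child _ _).2 h) y ((u.mem_child _ _).2 hy)
          exact hxy.ne this
        · refine ihx z hz hzp (hz.trans hxy) ?_
          rw [u.branchRoot_of_father_eq_succ hy, ← hb, u.branchRoot_of_father_eq_succ h]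

theorem STree.ext_father_color {t t' : STree q m} (hf : t.father = t'.father)
    (hc : t.color = t'.color) : t = t' := by
  cases t; cases t'; simp_all

/-- A special tree is determined by its partition into branches. -/
theorem IsSpecial.eq_of_branchRoot_eq {u u' : STree q 0} (hu : IsSpecial u) (hu' : IsSpecial u')
    (h : ∀ j, u.branchRoot j = u'.branchRoot j) : u = u' := by
  refine STree.ext_father_color (funext fun j => ?_) (funext fun j => Subsingleton.elim _ _)
  rcases u.father_eq_zero_or j with h0 | ⟨p, hp, h1⟩ <;>
    rcases u'.father_eq_zero_or j with h0' | ⟨p', hp', h1'⟩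
  · rw [h0, h0']
  · rw [h0]
    rwa [← u.branchRoot_eq_self_iff, h, u'.branchRoot_eq_self_iff, eq_comm] at h0
  · rw [h0']
    rwa [← u'.branchRoot_eq_self_iff, ← h, u.branchRoot_eq_self_iff] at h0'
  · rcases lt_trichotomy p p' with hl | rfl | hl
    · refine (hu.not_between j p p' h1 hl hp' ?_).elim
      rw [h, h, u'.branchRoot_of_father_eq_succ h1']
    · rw [h1, h1']
    · refine (hu'.not_between j p' p h1' hl hp ?_).elim
      rw [← h, ← h, u.branchRoot_of_father_eq_succ h1]

/-- Every partition into branches is realised by a special tree. -/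
theorem exists_isSpecial_branchRoot_eq (t : STree q m) :
    ∃ u : STree q 0, IsSpecial u ∧ ∀ j, u.branchRoot j = t.branchRoot j := by
  classical
  let P (j : Fin q) : Finset (Fin q) := {x | x < j ∧ t.branchRoot x = t.branchRoot j}
  have hP (j x : Fin q) : x ∈ P j ↔ x < j ∧ t.branchRoot x = t.branchRoot j := by simp [P]
  let f (j : Fin q) : Fin (q + 1) := if h : (P j).Nonempty then ((P j).max' h).succ else 0
  have hf (j p : Fin q) (h : f j = p.succ) : p ∈ P j ∧ ∀ x ∈ P j, x ≤ p := by
    by_cases hj : (P j).Nonempty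
    · simp only [f, hj, dite_true, Fin.succ_inj] at h
      subst h
      exact ⟨max'_mem _ _, fun x hx => le_max' _ _ hx⟩
    · simp only [f, hj, dite_false] at h
      exact absurd h.symm (Fin.succ_ne_zero _)
  let u : STree q 0 := ⟨f, fun _ => none, fun j => by
    rcases Fin.eq_zero_or_eq_succ (f j) with h | ⟨p, h⟩
    · simp [h]
    · have := ((hP _ _).1 (hf j p h).1).1
      rw [h, Fin.val_succ]
      exact this⟩
  refine ⟨u, fun p => Finset.card_le_one.2 ?_, u.branchRoot_unique _ ?_ ?_⟩
  · intro a ha b hb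
    rw [STree.mem_child] at ha hb
    obtain ⟨ha1, ha2⟩ := hf a p ha
    obtain ⟨hb1, hb2⟩ := hf b p hb
    rw [hP] at ha1 hb1
    by_contra hne
    rcases lt_or_gt_of_ne hne with hl | hl
    · exact absurd (hb2 a ((hP _ _).2 ⟨hl, ha1.2.symm.trans hb1.2⟩)) (not_le.2 ha1.1)
    · exact absurd (ha2 b ((hP _ _).2 ⟨hl, hb1.2.symm.trans ha1.2⟩)) (not_le.2 hb1.1)
  · intro j hj
    by_contra hne
    have hne' : (P j).Nonempty := ⟨t.branchRoot j, (hP _ _).2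
      ⟨lt_of_le_of_ne (t.branchRoot_le j) hne,
        t.branchRoot_of_father_eq_zero (t.father_branchRoot j).1⟩⟩
    have : f j = 0 := hj
    simp only [f, hne', dite_true] at this
    exact Fin.succ_ne_zero _ this
  · intro j p h
    exact ((hP _ _).1 (hf j p h).1).2.symm

end Branches

section Density

variable {q m : ℕ}

theorem STree.lt_of_mem_child (t : STree q m) {i c : Fin q} (h : c ∈ t.child i.succ) : i < c := by
  rw [STree.mem_child] at h
  have := t.mono c
  rw [h, Fin.val_succ] at this
  exact this

theorem sizeAux_eq (t : STree q m) (f f' : ℕ) (i : Fin q) (hf : q ≤ f + i)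
    (hf' : q ≤ f' + i) : sizeAux t f i = sizeAux t f' i := by
  induction f generalizing f' i with
  | zero => omega
  | succ f ih =>
    obtain ⟨g, rfl⟩ : ∃ g, f' = g + 1 := ⟨f' - 1, by omega⟩
    simp only [sizeAux]
    congr 1
    refine Finset.sum_congr rfl fun c hc => ?_
    have := Fin.lt_def.1 (t.lt_of_mem_child hc)
    exact ih g c (by omega) (by omega)

theorem densAux_eq (t : STree q m) (f f' : ℕ) (i : Fin q) (hf : q ≤ f + i)
    (hf' : q ≤ f' + i) : densAux t f i = densAux t f' i := by
  induction f generalizing f' i with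
  | zero => omega
  | succ f ih =>
    obtain ⟨g, rfl⟩ : ∃ g, f' = g + 1 := ⟨f' - 1, by omega⟩
    simp only [densAux]
    congr 1
    refine Finset.prod_congr rfl fun c hc => ?_
    have := Fin.lt_def.1 (t.lt_of_mem_child hc)
    exact ih g c (by omega) (by omega)

theorem STree.size_eq (t : STree q m) (i : Fin q) :
    t.size i = 1 + ∑ c ∈ t.child i.succ, t.size c := by
  unfold STree.size
  rw [sizeAux_eq t q (q + 1) i (by omega) (by omega), sizeAux]

theorem STree.densNode_eq (t : STree q m) (i : Fin q) :
    t.densNode i = t.size i * ∏ c ∈ t.child i.succ, t.densNode c := by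
  unfold STree.densNode
  rw [densAux_eq t q (q + 1) i (by omega) (by omega), densAux]

theorem STree.sum_size_child_zero (t : STree q m) : ∑ c ∈ t.child 0, t.size c = q := by
  have h1 : ∑ i, t.size i = q + ∑ i : Fin q, ∑ c ∈ t.child i.succ, t.size c := by
    rw [Finset.sum_congr rfl fun i _ => t.size_eq i, Finset.sum_add_distrib]
    simp
  have h2 : ∑ v, ∑ c ∈ t.child v, t.size c = ∑ i, t.size i := by
    unfold STree.child
    exact Finset.sum_fiberwise _ _ _
  rw [Fin.sum_univ_succ] at h2
  omega

theorem STree.size_embedded {l : ℕ} (s : STree l m) (t : STree q m) (e : Fin (l + 1) ↪ Fin q)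
    (he : ∀ v, t.child (e v).succ = (s.child v).map ((Fin.succEmb l).trans e)) (k : Fin l) :
    t.size (e k.succ) = s.size k := by
  induction k using WellFoundedGT.induction with
  | _ k ih =>
    rw [t.size_eq, s.size_eq, he, Finset.sum_map]
    congr 1
    exact Finset.sum_congr rfl fun c hc => ih c (s.lt_of_mem_child hc)

theorem STree.densNode_embedded {l : ℕ} (s : STree l m) (t : STree q m) (e : Fin (l + 1) ↪ Fin q)
    (he : ∀ v, t.child (e v).succ = (s.child v).map ((Fin.succEmb l).trans e)) (k : Fin l) :
    t.densNode (e k.succ) = s.densNode k := by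
  induction k using WellFoundedGT.induction with
  | _ k ih =>
    rw [t.densNode_eq, s.densNode_eq, STree.size_embedded s t e he, he, Finset.prod_map]
    congr 1
    exact Finset.prod_congr rfl fun c hc => ih c (s.lt_of_mem_child hc)

theorem STree.densNode_embedded_zero {l : ℕ} (s : STree l m) (t : STree q m) (e : Fin (l + 1) ↪ Fin q)
    (he : ∀ v, t.child (e v).succ = (s.child v).map ((Fin.succEmb l).trans e)) :
    t.densNode (e 0) = s.densR := by
  have h : t.size (e 0) = l + 1 := by
    rw [t.size_eq, he, Finset.sum_map, add_comm]
    congr 1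
    refine (Finset.sum_congr rfl fun c _ => ?_).trans s.sum_size_child_zero
    exact STree.size_embedded s t e he c
  rw [t.densNode_eq, STree.densR, h, he, Finset.prod_map]
  congr 1
  exact Finset.prod_congr rfl fun c _ => STree.densNode_embedded s t e he c

end Density

section Grafting

variable {q m : ℕ}

/-- The `i`-th son of the root. -/
def STree.rootChild (u : STree q m) (i : Fin (u.child 0).card) : Fin q :=
  ((u.child 0).orderIsoOfFin rfl i).1

theorem STree.father_rootChild (u : STree q m) (i : Fin (u.child 0).card) :
    u.father (u.rootChild i) = 0 :=
  (u.mem_child _ _).1 ((u.child 0).orderIsoOfFin rfl i).2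

theorem STree.rootChild_injective (u : STree q m) : Function.Injective u.rootChild :=
  Subtype.val_injective.comp ((u.child 0).orderIsoOfFin rfl).injective

theorem STree.rootChild_mem_branchSet (u : STree q m) (i : Fin (u.child 0).card) :
    u.rootChild i ∈ u.branchSet (u.rootChild i) :=
  (u.mem_branchSet _ _).2 (u.branchRoot_of_father_eq_zero (u.father_rootChild i))

theorem STree.card_branchSet (u : STree q m) (i : Fin (u.child 0).card) :
    (u.branchSet (u.rootChild i)).card = (u.branchSet (u.rootChild i)).card - 1 + 1 :=
  (Nat.succ_pred_eq_of_pos (Finset.card_pos.2 ⟨_, u.rootChild_mem_branchSet i⟩)).symm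

/-- The increasing enumeration of the nodes of the `i`-th branch. -/
def STree.branchEmb (u : STree q m) (i : Fin (u.child 0).card) :
    Fin ((u.branchSet (u.rootChild i)).card - 1 + 1) ↪o Fin q :=
  (u.branchSet (u.rootChild i)).orderEmbOfFin (u.card_branchSet i)

theorem STree.orderIsoOfFin_eq_branchEmb (u : STree q m) (i : Fin (u.child 0).card)
    (k : Fin ((u.branchSet (u.rootChild i)).card - 1 + 1))
    (h : k.val < (u.branchSet (u.rootChild i)).card) :
    ((u.branchSet (u.rootChild i)).orderIsoOfFin rfl ⟨k.val, h⟩).1 = u.branchEmb i k :=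
  (Finset.orderEmbOfFin_eq_orderEmbOfFin_iff (h := rfl) (h' := u.card_branchSet i)).2 rfl

theorem STree.branchRoot_branchEmb (u : STree q m) (i : Fin (u.child 0).card)
    (k : Fin ((u.branchSet (u.rootChild i)).card - 1 + 1)) :
    u.branchRoot (u.branchEmb i k) = u.rootChild i :=
  (u.mem_branchSet _ _).1 (Finset.orderEmbOfFin_mem _ _ _)

theorem STree.exists_rootChild_eq (u : STree q m) {j : Fin q} (h : u.father j = 0) :
    ∃ i, u.rootChild i = j := by
  refine ⟨((u.child 0).orderIsoOfFin rfl).symm ⟨j, (u.mem_child _ _).2 h⟩, ?_⟩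
  simp [STree.rootChild]

theorem STree.exists_branchEmb_eq_of_branchRoot (u : STree q m) (i : Fin (u.child 0).card)
    {j : Fin q} (h : u.branchRoot j = u.rootChild i) : ∃ k, u.branchEmb i k = j := by
  have : j ∈ Set.range (u.branchEmb i) := by
    unfold STree.branchEmb
    rw [Finset.range_orderEmbOfFin]
    exact (u.mem_branchSet _ _).2 h
  exact this

theorem STree.exists_branchEmb_eq (u : STree q m) (j : Fin q) : ∃ i k, u.branchEmb i k = j := by
  obtain ⟨i, hi⟩ := u.exists_rootChild_eq (u.father_branchRoot j).1
  exact ⟨i, u.exists_branchEmb_eq_of_branchRoot i hi.symm⟩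

theorem STree.branchEmb_zero (u : STree q m) (i : Fin (u.child 0).card) :
    u.branchEmb i 0 = u.rootChild i := by
  obtain ⟨k, hk⟩ := u.exists_branchEmb_eq_of_branchRoot i
    (u.branchRoot_of_father_eq_zero (u.father_rootChild i))
  refine le_antisymm ?_ ?_
  · exact ((u.branchEmb i).monotone (Fin.zero_le k)).trans_eq hk
  · exact (u.branchRoot_branchEmb i 0).symm.trans_le (u.branchRoot_le _)

/-- The root colour of the `i`-th tree of a tuple. -/
def GraftTup.rootColor {u : STree q 0} (tup : GraftTup m u) (i : Fin (u.child 0).card) :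
    Option (Fin m) :=
  (tup i).1

/-- The `i`-th tree of a tuple. -/
def GraftTup.tree {u : STree q 0} (tup : GraftTup m u) (i : Fin (u.child 0).card) :
    STree ((u.branchSet (u.rootChild i)).card - 1) m :=
  (tup i).2

theorem graftFather_branchEmb_of_eq (u : STree q 0) (tup : GraftTup m u)
    (i : Fin (u.child 0).card) (k : Fin ((u.branchSet (u.rootChild i)).card - 1 + 1))
    (κ : Fin (u.branchSet (u.rootChild i)).card) (hκ : κ.val = k.val) :
    (if hk : κ.val = 0 then (0 : Fin (q + 1)) else
      if hf : ((tup.tree i).father ⟨κ.val - 1, Nat.sub_lt_sub_right (Nat.pos_of_ne_zero hk) κ.isLt⟩).val <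
          (u.branchSet (u.rootChild i)).card then
        ((u.branchSet (u.rootChild i)).orderIsoOfFin rfl ⟨_, hf⟩).1.succ else 0) =
      Fin.cases (motive := fun _ => Fin (q + 1)) 0
        (fun k' => (u.branchEmb i ((tup.tree i).father k')).succ) k := by
  obtain ⟨κ, hlt⟩ := κ
  dsimp only at hκ
  subst hκ
  cases k using Fin.cases with
  | zero => exact dif_pos rfl
  | succ k =>
    refine (dif_neg (Nat.succ_ne_zero _)).trans ((dif_pos ?_).trans ?_)
    · exact (Fin.isLt _).trans_eq (u.card_branchSet i).symm
    · exact congrArg Fin.succ (u.orderIsoOfFin_eq_branchEmb i _ _)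

theorem graftColor_branchEmb_of_eq (u : STree q 0) (tup : GraftTup m u)
    (i : Fin (u.child 0).card) (k : Fin ((u.branchSet (u.rootChild i)).card - 1 + 1))
    (κ : Fin (u.branchSet (u.rootChild i)).card) (hκ : κ.val = k.val) :
    (if κ.val = 0 then tup.rootColor i else
      if h : κ.val - 1 < (u.branchSet (u.rootChild i)).card - 1 then
        (tup.tree i).color ⟨κ.val - 1, h⟩ else none) =
      Fin.cases (motive := fun _ => Option (Fin m)) (tup.rootColor i)
        (fun k' => (tup.tree i).color k') k := by
  obtain ⟨κ, hlt⟩ := κ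
  dsimp only at hκ
  subst hκ
  cases k using Fin.cases with
  | zero => exact if_pos rfl
  | succ k => exact (if_neg (Nat.succ_ne_zero _)).trans (dif_pos k.isLt)

theorem STree.orderIsoOfFin_symm_branchEmb (u : STree q m) (i : Fin (u.child 0).card)
    (k : Fin ((u.branchSet (u.rootChild i)).card - 1 + 1))
    (hj : u.branchEmb i k ∈ u.branchSet (u.rootChild i)) :
    (((u.branchSet (u.rootChild i)).orderIsoOfFin rfl).symm ⟨_, hj⟩).val = k.val := by
  have h : (⟨_, hj⟩ : u.branchSet (u.rootChild i)) =
      (u.branchSet (u.rootChild i)).orderIsoOfFin rfl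
        ⟨k.val, k.isLt.trans_eq (u.card_branchSet i).symm⟩ :=
    Subtype.ext (u.orderIsoOfFin_eq_branchEmb i k _).symm
  rw [h, OrderIso.symm_apply_apply]

theorem graftFather_and_graftColor (u : STree q 0) (tup : GraftTup m u) (i : Fin (u.child 0).card)
    (k : Fin ((u.branchSet (u.rootChild i)).card - 1 + 1)) :
    graftFather m u tup (u.branchEmb i k) =
        Fin.cases (motive := fun _ => Fin (q + 1)) 0
          (fun k' => (u.branchEmb i ((tup.tree i).father k')).succ) k ∧
      graftColor m u tup (u.branchEmb i k) =
        Fin.cases (motive := fun _ => Option (Fin m)) (tup.rootColor i)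
          (fun k' => (tup.tree i).color k') k := by
  have hbr := u.branchRoot_branchEmb i k
  have hR := u.branchRoot_mem_child (u.branchEmb i k)
  have hj : u.branchEmb i k ∈ u.branchSet (u.rootChild i) := (u.mem_branchSet _ _).2 hbr
  have hi : i = ((u.child 0).orderIsoOfFin rfl).symm ⟨u.branchRoot (u.branchEmb i k), hR⟩ := by
    rw [OrderIso.eq_symm_apply]
    exact Subtype.ext hbr.symm
  have hk := u.orderIsoOfFin_symm_branchEmb i k hj
  generalize u.branchEmb i k = j at *
  unfold graftFather graftColor
  rw [dif_pos hR, dif_pos hR]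
  subst hi
  exact ⟨(dif_pos hj).trans (graftFather_branchEmb_of_eq u tup _ k _ hk),
    (dif_pos hj).trans (graftColor_branchEmb_of_eq u tup _ k _ hk)⟩

theorem graftFather_le (u : STree q 0) (tup : GraftTup m u) (j : Fin q) :
    (graftFather m u tup j).val ≤ j.val := by
  obtain ⟨i, k, rfl⟩ := u.exists_branchEmb_eq j
  rw [(graftFather_and_graftColor u tup i k).1]
  cases k using Fin.cases with
  | zero => exact Nat.zero_le _
  | succ k =>
    have h : (tup.tree i).father k < k.succ := Nat.lt_succ_of_le ((tup.tree i).mono k)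
    exact (u.branchEmb i).strictMono h

theorem graft_eq (u : STree q 0) (tup : GraftTup m u) :
    graft m u tup = ⟨graftFather m u tup, graftColor m u tup, graftFather_le u tup⟩ :=
  dif_pos (graftFather_le u tup)

theorem graft_father_zero (u : STree q 0) (tup : GraftTup m u) (i : Fin (u.child 0).card) :
    (graft m u tup).father (u.branchEmb i 0) = 0 := by
  rw [graft_eq]
  exact (graftFather_and_graftColor u tup i 0).1

theorem graft_father_succ (u : STree q 0) (tup : GraftTup m u) (i : Fin (u.child 0).card)
    (k : Fin ((u.branchSet (u.rootChild i)).card - 1)) :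
    (graft m u tup).father (u.branchEmb i k.succ) =
      (u.branchEmb i ((tup.tree i).father k)).succ := by
  rw [graft_eq]
  exact (graftFather_and_graftColor u tup i k.succ).1

theorem graft_color_zero (u : STree q 0) (tup : GraftTup m u) (i : Fin (u.child 0).card) :
    (graft m u tup).color (u.branchEmb i 0) = tup.rootColor i := by
  rw [graft_eq]
  exact (graftFather_and_graftColor u tup i 0).2

theorem graft_color_succ (u : STree q 0) (tup : GraftTup m u) (i : Fin (u.child 0).card)
    (k : Fin ((u.branchSet (u.rootChild i)).card - 1)) :
    (graft m u tup).color (u.branchEmb i k.succ) = (tup.tree i).color k := by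
  rw [graft_eq]
  exact (graftFather_and_graftColor u tup i k.succ).2

theorem branchRoot_graft (u : STree q 0) (tup : GraftTup m u) (j : Fin q) :
    (graft m u tup).branchRoot j = u.branchRoot j := by
  refine STree.branchRoot_unique _ _ (fun j h => ?_) (fun j p h => ?_) j <;>
    obtain ⟨i, k, rfl⟩ := u.exists_branchEmb_eq j <;>
    cases k using Fin.cases with
    | zero => ?_
    | succ k => ?_
  · rw [u.branchRoot_branchEmb, u.branchEmb_zero]
  · rw [graft_father_succ] at h
    exact (Fin.succ_ne_zero _ h).elim
  · rw [graft_father_zero] at h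
    exact (Fin.succ_ne_zero _ h.symm).elim
  · rw [graft_father_succ, Fin.succ_inj] at h
    rw [← h, u.branchRoot_branchEmb, u.branchRoot_branchEmb]

theorem child_zero_graft (u : STree q 0) (tup : GraftTup m u) :
    (graft m u tup).child 0 = u.child 0 := by
  ext j
  rw [STree.mem_child, STree.mem_child, ← STree.branchRoot_eq_self_iff, branchRoot_graft,
    STree.branchRoot_eq_self_iff]

theorem child_succ_graft (u : STree q 0) (tup : GraftTup m u) (i : Fin (u.child 0).card)
    (v : Fin ((u.branchSet (u.rootChild i)).card - 1 + 1)) :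
    (graft m u tup).child ((u.branchEmb i).toEmbedding v).succ =
      ((tup.tree i).child v).map ((Fin.succEmb _).trans (u.branchEmb i).toEmbedding) := by
  ext j
  rw [STree.mem_child, Finset.mem_map]
  constructor
  · intro h
    obtain ⟨i', k, rfl⟩ := u.exists_branchEmb_eq j
    cases k using Fin.cases with
    | zero =>
      rw [graft_father_zero] at h
      exact (Fin.succ_ne_zero _ h.symm).elim
    | succ k =>
      rw [graft_father_succ, Fin.succ_inj] at h
      obtain rfl : i' = i := u.rootChild_injective <| by
        rw [← u.branchRoot_branchEmb i' ((tup.tree i').father k), h]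
        exact u.branchRoot_branchEmb i v
      exact ⟨k, ((tup.tree i').mem_child _ _).2 ((u.branchEmb i').injective h), rfl⟩
  · rintro ⟨k, hk, rfl⟩
    rw [STree.mem_child] at hk
    subst hk
    exact graft_father_succ u tup i k

theorem densR_graft (u : STree q 0) (tup : GraftTup m u) :
    (graft m u tup).densR = (q + 1) * ∏ i, (tup.tree i).densR := by
  have hroot : u.child 0 = Finset.univ.map ⟨u.rootChild, u.rootChild_injective⟩ := by
    ext j
    simp only [STree.mem_child, Finset.mem_map, Finset.mem_univ, true_and]
    exact ⟨u.exists_rootChild_eq, by rintro ⟨i, rfl⟩; exact u.father_rootChild i⟩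
  rw [STree.densR, child_zero_graft]
  congr 1
  refine (Finset.prod_congr hroot fun _ _ => rfl).trans ((Finset.prod_map _ _ _).trans ?_)
  refine Finset.prod_congr rfl fun i _ => ?_
  have h := STree.densNode_embedded_zero _ _ _ (child_succ_graft u tup i)
  exact (congrArg _ (u.branchEmb_zero i).symm).trans h

theorem graft_injective (u : STree q 0) : Function.Injective (graft m u) := by
  intro tup tup' h
  have hcolor (i) : tup.rootColor i = tup'.rootColor i := by
    rw [← graft_color_zero, h, graft_color_zero]
  have htree (i) : tup.tree i = tup'.tree i := by
    refine STree.ext_father_color (funext fun k => ?_) (funext fun k => ?_)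
    · refine (u.branchEmb i).injective (Fin.succ_injective _ ?_)
      rw [← graft_father_succ, h, graft_father_succ]
    · rw [← graft_color_succ, h, graft_color_succ]
  exact funext fun i => Prod.ext (hcolor i) (htree i)

theorem exists_graft_eq (t : STree q m) (u : STree q 0)
    (hu : ∀ j, u.branchRoot j = t.branchRoot j) : ∃ tup : GraftTup m u, graft m u tup = t := by
  have hroot (i : Fin (u.child 0).card) : t.father (u.branchEmb i 0) = 0 := by
    rw [← t.branchRoot_eq_self_iff, ← hu, u.branchRoot_branchEmb, u.branchEmb_zero]
  have hfather (i : Fin (u.child 0).card) (k : Fin ((u.branchSet (u.rootChild i)).card - 1)) :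
      ∃ v, t.father (u.branchEmb i k.succ) = (u.branchEmb i v).succ := by
    rcases t.father_eq_zero_or (u.branchEmb i k.succ) with h | ⟨p, -, h⟩
    · rw [← t.branchRoot_eq_self_iff, ← hu] at h
      have h0 := ((u.branchEmb_zero i).trans (u.branchRoot_branchEmb i k.succ).symm).trans h
      exact (Fin.succ_ne_zero _ ((u.branchEmb i).injective h0).symm).elim
    · have hp : u.branchRoot p = u.rootChild i := by
        rw [hu, ← t.branchRoot_of_father_eq_succ h, ← hu, u.branchRoot_branchEmb]
      obtain ⟨v, rfl⟩ := u.exists_branchEmb_eq_of_branchRoot i hp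
      exact ⟨v, h⟩
  choose F hF using hfather
  have hmono (i) (k) : (F i k).val ≤ k.val := by
    have h := t.mono (u.branchEmb i k.succ)
    rw [hF, Fin.val_succ, Nat.succ_le_iff, ← Fin.lt_def, (u.branchEmb i).lt_iff_lt] at h
    exact Nat.le_of_lt_succ h
  let tup : GraftTup m u := fun i => (t.color (u.branchEmb i 0),
    ⟨F i, fun k => t.color (u.branchEmb i k.succ), hmono i⟩)
  refine ⟨tup, ?_⟩
  refine STree.ext_father_color (funext fun j => ?_) (funext fun j => ?_) <;>
    obtain ⟨i, k, rfl⟩ := u.exists_branchEmb_eq j <;>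
    cases k using Fin.cases with
    | zero => ?_
    | succ k => ?_
  · rw [graft_father_zero, hroot]
  · exact (graft_father_succ u tup i k).trans (hF i k).symm
  · exact graft_color_zero u tup i
  · exact graft_color_succ u tup i k

end Grafting

/-- the grafting operation is a bijection from tuples
`(u, t_1, …, t_{m(u)})` (with `u` special with root colour `π` and `l(t_i) = δ_i`)
onto the monotonically labelled S-trees with `q'+1` nodes and root colour `π`, and
under it the density is multiplicative: `γ(t) = q·γ(t_1)⋯γ(t_{m(u)})`. -/
theorem tree_grafting_bijection (m q' : ℕ) (hq : 1 ≤ q') (π : Option (Fin m)) :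
    Function.Bijective
      (fun tup : (Σ u : {u : STree q' 0 // IsSpecial u}, GraftTup m u.1) =>
        (⟨(π, graft m tup.1.1 tup.2), rfl⟩ : {tt : Option (Fin m) × STree q' m // tt.1 = π}))
    ∧ ∀ (u : {u : STree q' 0 // IsSpecial u}) (tup : GraftTup m u.1),
        ((graft m u.1 tup).densR : ℝ)
          = ((q' + 1 : ℕ) : ℝ) * ∏ i, (((tup i).2).densR : ℝ) := by
  refine ⟨⟨?_, ?_⟩, fun u tup => ?_⟩
  · rintro ⟨⟨u, hu⟩, tup⟩ ⟨⟨u', hu'⟩, tup'⟩ h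
    have h' : graft m u tup = graft m u' tup' := congrArg (fun x => x.1.2) h
    obtain rfl : u = u' := hu.eq_of_branchRoot_eq hu' fun j => by
      rw [← branchRoot_graft u tup, h', branchRoot_graft]
    rw [graft_injective u h']
  · rintro ⟨⟨_, t⟩, rfl⟩
    obtain ⟨u, hu, hut⟩ := exists_isSpecial_branchRoot_eq t
    obtain ⟨tup, rfl⟩ := exists_graft_eq t u hut
    exact ⟨⟨⟨u, hu⟩, tup⟩, rfl⟩
  · rw [densR_graft]
    push_cast
    rfl

end SRKPaper
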